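/- Invariance lemma (Lemma 6): Under Assumptions 1, 2, 3, the argmax-attainment property of π_H, and the shield property of π_R, suppose x' ∈ Xinv. Set x = f_H(x', π_H x'), x₊' = f_R(x, π_R x), and x₊ = f_H(x₊', π_H x₊'). Then x₊' ∈ Xinv, x₊' ∈ Xsafe, and x₊ ∈ Xsafe. -/

import Mathlib

variable {𝒳 𝒰R 𝒰H : Type*}

/-- Primed states of the human-first trajectory ζ_H(x', uH, uR):
`trajP fR fH x' uH uR t` is x'_t, where x'_0 = x',
x_t = fH (x'_t) (uH t), and x'_{t+1} = fR (x_t) (uR t). -/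
def trajP (fR : 𝒳 → 𝒰R → 𝒳) (fH : 𝒳 → 𝒰H → 𝒳) (x' : 𝒳)
    (uH : ℕ → 𝒰H) (uR : ℕ → 𝒰R) : ℕ → 𝒳
  | 0 => x'
  | t + 1 => fR (fH (trajP fR fH x' uH uR t) (uH t)) (uR t)

/-- The human-first trajectory is safe up to time k. -/
def SafeUpTo (fR : 𝒳 → 𝒰R → 𝒳) (fH : 𝒳 → 𝒰H → 𝒳) (Xsafe : Set 𝒳)
    (x' : 𝒳) (uH : ℕ → 𝒰H) (uR : ℕ → 𝒰R) (k : ℕ) : Prop :=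
  ∀ t ≤ k, trajP fR fH x' uH uR t ∈ Xsafe ∧
    fH (trajP fR fH x' uH uR t) (uH t) ∈ Xsafe

/-- Safe equilibrium states. -/
def Xeq (fR : 𝒳 → 𝒰R → 𝒳) (fH : 𝒳 → 𝒰H → 𝒳) (Xsafe : Set 𝒳)
    (uR0 : 𝒰R) (UH0 : Set 𝒰H) : Set 𝒳 :=
  {x | x ∈ Xsafe ∧ fR x uR0 = x ∧ ∀ uH ∈ UH0, fH x uH = x}

/-- Recoverable states. -/
def Xrec (fR : 𝒳 → 𝒰R → 𝒳) (fH : 𝒳 → 𝒰H → 𝒳) (Xsafe : Set 𝒳)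
    (uR0 : 𝒰R) (UH0 : Set 𝒰H) (k : ℕ) : Set 𝒳 :=
  {x' | ∀ uH : ℕ → 𝒰H, (∀ t, uH t ∈ UH0) →
    SafeUpTo fR fH Xsafe x' uH (fun _ => uR0) k ∧
    fH (trajP fR fH x' uH (fun _ => uR0) k) (uH k) ∈ Xeq fR fH Xsafe uR0 UH0}

open Filter in
/-- Discounted objective of a human-first trajectory, computed in `EReal`
as the liminf of the partial sums. -/
noncomputable def J (fR : 𝒳 → 𝒰R → 𝒳) (fH : 𝒳 → 𝒰H → 𝒳)
    (rH : 𝒳 → 𝒰H → 𝒳 → EReal) (γ : ℝ)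
    (x' : 𝒳) (uH : ℕ → 𝒰H) (uR : ℕ → 𝒰R) : EReal :=
  Filter.atTop.liminf fun n => ∑ t ∈ Finset.range n,
    ((γ ^ t : ℝ) : EReal) *
      rH (trajP fR fH x' uH uR t) (uH t) (fH (trajP fR fH x' uH uR t) (uH t))

/-- Robust human objective: worst case over anticipated robot action sequences. -/
noncomputable def JH (fR : 𝒳 → 𝒰R → 𝒳) (fH : 𝒳 → 𝒰H → 𝒳)
    (rH : 𝒳 → 𝒰H → 𝒳 → EReal) (γ : ℝ) (URhat : Set 𝒰R)
    (x' : 𝒳) (uH : ℕ → 𝒰H) : EReal :=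
  ⨅ uR : {u : ℕ → 𝒰R // ∀ t, u t ∈ URhat}, J fR fH rH γ x' uH uR.val

/-- Human value: best case over human action sequences. -/
noncomputable def JHval (fR : 𝒳 → 𝒰R → 𝒳) (fH : 𝒳 → 𝒰H → 𝒳)
    (rH : 𝒳 → 𝒰H → 𝒳 → EReal) (γ : ℝ) (URhat : Set 𝒰R) (x' : 𝒳) : EReal :=
  ⨆ uH : ℕ → 𝒰H, JH fR fH rH γ URhat x' uH

/-- Invariant states. -/
noncomputable def Xinv (fR : 𝒳 → 𝒰R → 𝒳) (fH : 𝒳 → 𝒰H → 𝒳) (Xsafe : Set 𝒳)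
    (uR0 : 𝒰R) (UH0 : Set 𝒰H) (k : ℕ)
    (rH : 𝒳 → 𝒰H → 𝒳 → EReal) (γ : ℝ) (URhat : Set 𝒰R)
    (πH : 𝒳 → 𝒰H) (πR : 𝒳 → 𝒰R) : Set 𝒳 :=
  {x' | JHval fR fH rH γ URhat x' > ⊥ ∨
    fR (fH x' (πH x')) (πR (fH x' (πH x'))) ∈ Xrec fR fH Xsafe uR0 UH0 k}

/-- Shifting a trajectory by one step restarts it from its second primed state. -/
lemma trajP_cons (fR : 𝒳 → 𝒰R → 𝒳) (fH : 𝒳 → 𝒰H → 𝒳) (x' : 𝒳)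
    (uH : ℕ → 𝒰H) (uR : ℕ → 𝒰R) (t : ℕ) :
    trajP fR fH x' uH uR (t + 1) =
      trajP fR fH (fR (fH x' (uH 0)) (uR 0)) (fun n => uH (n + 1)) (fun n => uR (n + 1)) t := by
  induction t with
  | zero => rfl
  | succ t ih => rw [trajP, ih, trajP]

lemma EReal.sum_mul_pow_succ {γ : ℝ} (hγ : 0 ≤ γ) (r : ℕ → EReal) (n : ℕ) :
    ∑ t ∈ Finset.range (n + 1), ((γ ^ t : ℝ) : EReal) * r t =
      r 0 + (γ : EReal) * ∑ t ∈ Finset.range n, ((γ ^ t : ℝ) : EReal) * r (t + 1) := by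
  induction n with
  | zero => simp
  | succ n ih =>
    rw [Finset.sum_range_succ, ih, Finset.sum_range_succ _ n,
      EReal.left_distrib_of_nonneg_of_ne_top (EReal.coe_nonneg.2 hγ) (EReal.coe_ne_top γ),
      add_assoc, ← mul_assoc, ← EReal.coe_mul, pow_succ']

/-- A trajectory with objective above `⊥` has an initial reward above `⊥`. -/
lemma reward_zero_ne_bot_of_J {fR : 𝒳 → 𝒰R → 𝒳} {fH : 𝒳 → 𝒰H → 𝒳}
    {rH : 𝒳 → 𝒰H → 𝒳 → EReal} {γ : ℝ} (hγ : 0 ≤ γ) {x' : 𝒳} {uH : ℕ → 𝒰H} {uR : ℕ → 𝒰R}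
    (h : ⊥ < J fR fH rH γ x' uH uR) : rH x' (uH 0) (fH x' (uH 0)) ≠ ⊥ := by
  intro h0
  obtain ⟨n, hn⟩ := Filter.eventually_atTop.1 (Filter.eventually_lt_of_lt_liminf h)
  have h1 := hn (n + 1) n.le_succ
  rw [EReal.sum_mul_pow_succ hγ fun t =>
    rH (trajP fR fH x' uH uR t) (uH t) (fH (trajP fR fH x' uH uR t) (uH t))] at h1
  simp [trajP, h0] at h1

/-- A lower bound on the objective passes to the tail of the trajectory, uniformly in the
robot actions of the tail. -/
lemma le_J_tail {fR : 𝒳 → 𝒰R → 𝒳} {fH : 𝒳 → 𝒰H → 𝒳}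
    {rH : 𝒳 → 𝒰H → 𝒳 → EReal} {γ : ℝ} (hγ : 0 < γ) {x' : 𝒳} {uH : ℕ → 𝒰H} {uR : ℕ → 𝒰R}
    {c r : ℝ} (hr : rH x' (uH 0) (fH x' (uH 0)) = r) (h : c < J fR fH rH γ x' uH uR) :
    (((c - r) / γ : ℝ) : EReal) ≤ J fR fH rH γ (fR (fH x' (uH 0)) (uR 0))
      (fun n => uH (n + 1)) (fun n => uR (n + 1)) := by
  refine Filter.le_liminf_of_le (by isBoundedDefault) ?_
  have hev := (Filter.tendsto_add_atTop_nat 1).eventually (Filter.eventually_lt_of_lt_liminf h)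
  filter_upwards [hev] with n hn
  rw [EReal.sum_mul_pow_succ hγ.le fun t =>
    rH (trajP fR fH x' uH uR t) (uH t) (fH (trajP fR fH x' uH uR t) (uH t))] at hn
  simp only [trajP_cons] at hn
  rw [trajP, hr] at hn
  generalize (∑ t ∈ Finset.range n, _ : EReal) = T at hn ⊢
  induction T with
  | bot => simp [EReal.coe_mul_bot_of_pos hγ] at hn
  | top => exact le_top
  | coe T =>
    norm_cast at hn ⊢
    rw [div_le_iff₀ hγ]
    linarith

/-- States of value above `⊥` are safe, before and after the human acts. -/
lemma safe_of_bot_lt_JHval {fR : 𝒳 → 𝒰R → 𝒳} {fH : 𝒳 → 𝒰H → 𝒳} {Xsafe : Set 𝒳}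
    {uR0 : 𝒰R} {γ : ℝ} (hγ : 0 ≤ γ) {URhat : Set 𝒰R} {rH : 𝒳 → 𝒰H → 𝒳 → EReal}
    (hA1 : ∀ x' u x, x' ∉ Xsafe ∨ x ∉ Xsafe → rH x' u x = ⊥) (hA2 : uR0 ∈ URhat)
    {πH : 𝒳 → 𝒰H}
    (hπHmax : ∀ x' : 𝒳, JHval fR fH rH γ URhat x' > ⊥ →
      ∃ uH : ℕ → 𝒰H, uH 0 = πH x' ∧
        JH fR fH rH γ URhat x' uH = JHval fR fH rH γ URhat x')
    {x' : 𝒳} (h : JHval fR fH rH γ URhat x' > ⊥) :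
    x' ∈ Xsafe ∧ fH x' (πH x') ∈ Xsafe := by
  obtain ⟨uH, h0, hJ⟩ := hπHmax x' h
  have hlt : ⊥ < J fR fH rH γ x' uH fun _ => uR0 :=
    (hJ ▸ h : ⊥ < JH fR fH rH γ URhat x' uH).trans_le
      (iInf_le (fun uR : {u : ℕ → 𝒰R // ∀ t, u t ∈ URhat} => J fR fH rH γ x' uH uR.val)
        ⟨fun _ => uR0, fun _ => hA2⟩)
  have hr := reward_zero_ne_bot_of_J hγ hlt
  rw [h0] at hr
  by_contra hs
  exact hr (hA1 _ _ _ (not_and_or.1 hs))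

/-- If a human action sequence has robust objective above `⊥`, then taking its first action,
followed by an anticipated robot action, leads to a state of value above `⊥`. -/
lemma bot_lt_JHval_step {fR : 𝒳 → 𝒰R → 𝒳} {fH : 𝒳 → 𝒰H → 𝒳}
    {uR0 : 𝒰R} {γ : ℝ} (hγ : 0 < γ) {URhat : Set 𝒰R} {rH : 𝒳 → 𝒰H → 𝒳 → EReal}
    (hrtop : ∀ x' u x, rH x' u x < ⊤) (hA2 : uR0 ∈ URhat)
    {x' : 𝒳} {uH : ℕ → 𝒰H} (h : ⊥ < JH fR fH rH γ URhat x' uH) :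
    ⊥ < JHval fR fH rH γ URhat (fR (fH x' (uH 0)) uR0) := by
  have hle (uR : ℕ → 𝒰R) (huR : ∀ t, uR t ∈ URhat) :
      JH fR fH rH γ URhat x' uH ≤ J fR fH rH γ x' uH uR :=
    iInf_le (fun uR : {u : ℕ → 𝒰R // ∀ t, u t ∈ URhat} => J fR fH rH γ x' uH uR.val) ⟨uR, huR⟩
  have hbot := reward_zero_ne_bot_of_J hγ.le (h.trans_le (hle _ fun _ => hA2))
  obtain ⟨r, hr⟩ : ∃ r : ℝ, rH x' (uH 0) (fH x' (uH 0)) = r :=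
    ⟨_, (EReal.coe_toReal (hrtop _ _ _).ne hbot).symm⟩
  obtain ⟨c, -, hc⟩ := EReal.lt_iff_exists_real_btwn.1 h
  have htail : (((c - r) / γ : ℝ) : EReal) ≤
      JH fR fH rH γ URhat (fR (fH x' (uH 0)) uR0) (fun n => uH (n + 1)) := by
    refine le_iInf fun uR => ?_
    let w : ℕ → 𝒰R := fun n => n.casesOn uR0 uR.val
    have hw (t : ℕ) : w t ∈ URhat := by
      cases t
      exacts [hA2, uR.2 _]
    exact le_J_tail (uR := w) hγ hr (hc.trans_le (hle w hw))
  exact (EReal.bot_lt_coe _).trans_le (htail.trans (le_iSup (JH fR fH rH γ URhat _) _))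

/-- Recoverable states are safe, before and after a human backup action. -/
lemma safe_of_mem_Xrec {fR : 𝒳 → 𝒰R → 𝒳} {fH : 𝒳 → 𝒰H → 𝒳} {Xsafe : Set 𝒳}
    {uR0 : 𝒰R} {UH0 : Set 𝒰H} {k : ℕ} {x' : 𝒳} {u : 𝒰H} (hu : u ∈ UH0)
    (h : x' ∈ Xrec fR fH Xsafe uR0 UH0 k) : x' ∈ Xsafe ∧ fH x' u ∈ Xsafe :=
  (h (fun _ => u) fun _ => hu).1 0 k.zero_le

/-- Recoverability is preserved by a human backup action followed by the robot's. -/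
lemma step_mem_Xrec {fR : 𝒳 → 𝒰R → 𝒳} {fH : 𝒳 → 𝒰H → 𝒳} {Xsafe : Set 𝒳}
    {uR0 : 𝒰R} {UH0 : Set 𝒰H} {k : ℕ} {x' : 𝒳} {u : 𝒰H} (hu : u ∈ UH0)
    (h : x' ∈ Xrec fR fH Xsafe uR0 UH0 k) :
    fR (fH x' u) uR0 ∈ Xrec fR fH Xsafe uR0 UH0 k := by
  intro v hv
  let w : ℕ → 𝒰H := fun n => n.casesOn u v
  obtain ⟨hs, he⟩ := h w fun t => by cases t; exacts [hu, hv _]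
  have hshift (t : ℕ) : trajP fR fH (fR (fH x' u) uR0) v (fun _ => uR0) t =
      trajP fR fH x' w (fun _ => uR0) (t + 1) := (trajP_cons fR fH x' w (fun _ => uR0) t).symm
  have hk : trajP fR fH (fR (fH x' u) uR0) v (fun _ => uR0) k =
      fH (trajP fR fH x' w (fun _ => uR0) k) (w k) := (hshift k).trans he.2.1
  have hk' := he.2.2 _ (hv k)
  refine ⟨fun t ht => ?_, ?_⟩
  · rcases ht.lt_or_eq with ht | rfl
    · rw [hshift]
      exact hs (t + 1) ht
    · rw [hk, hk']
      exact ⟨he.1, he.1⟩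
  · rwa [hk, hk']

/-- Invariance lemma (Lemma 6). -/
theorem inv_preserved (fR : 𝒳 → 𝒰R → 𝒳) (fH : 𝒳 → 𝒰H → 𝒳) (Xsafe : Set 𝒳)
    (uR0 : 𝒰R) (UH0 : Set 𝒰H) (k : ℕ)
    (γ : ℝ) (hγ0 : 0 < γ) (hγ1 : γ < 1) (URhat : Set 𝒰R)
    (rH : 𝒳 → 𝒰H → 𝒳 → EReal)
    (hrtop : ∀ x' u x, rH x' u x < ⊤)
    (hA1 : ∀ x' u x, x' ∉ Xsafe ∨ x ∉ Xsafe → rH x' u x = ⊥)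
    (hA2 : uR0 ∈ URhat)
    (πH : 𝒳 → 𝒰H)
    (hπHmax : ∀ x' : 𝒳, JHval fR fH rH γ URhat x' > ⊥ →
      ∃ uH : ℕ → 𝒰H, uH 0 = πH x' ∧
        JH fR fH rH γ URhat x' uH = JHval fR fH rH γ URhat x')
    (hA3 : ∀ x' : 𝒳, JHval fR fH rH γ URhat x' = ⊥ → πH x' ∈ UH0)
    (πR : 𝒳 → 𝒰R)
    (hshield : ∀ x : 𝒳, πR x ≠ uR0 → fR x (πR x) ∈ Xrec fR fH Xsafe uR0 UH0 k)
    (x' : 𝒳) (hx' : x' ∈ Xinv fR fH Xsafe uR0 UH0 k rH γ URhat πH πR) :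
    fR (fH x' (πH x')) (πR (fH x' (πH x'))) ∈
      Xinv fR fH Xsafe uR0 UH0 k rH γ URhat πH πR ∧
    fR (fH x' (πH x')) (πR (fH x' (πH x'))) ∈ Xsafe ∧
    fH (fR (fH x' (πH x')) (πR (fH x' (πH x'))))
      (πH (fR (fH x' (πH x')) (πR (fH x' (πH x'))))) ∈ Xsafe := by
  have hsafe {z : 𝒳} := safe_of_bot_lt_JHval (x' := z) hγ0.le hA1 hA2 hπHmax
  have hstep : JHval fR fH rH γ URhat (fR (fH x' (πH x')) (πR (fH x' (πH x')))) > ⊥ ∨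
      fR (fH x' (πH x')) (πR (fH x' (πH x'))) ∈ Xrec fR fH Xsafe uR0 UH0 k := by
    refine hx'.elim (fun h => ?_) Or.inr
    by_cases hR : πR (fH x' (πH x')) = uR0
    · obtain ⟨uH, h0, hJ⟩ := hπHmax x' h
      rw [hR, ← h0]
      exact Or.inl (bot_lt_JHval_step hγ0 hrtop hA2 (hJ ▸ h))
    · exact Or.inr (hshield _ hR)
  generalize fR (fH x' (πH x')) (πR (fH x' (πH x'))) = p at hstep ⊢
  by_cases hp : JHval fR fH rH γ URhat p > ⊥
  · exact ⟨Or.inl hp, hsafe hp⟩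
  · have hu := hA3 p (not_bot_lt_iff.1 hp)
    have hrec := hstep.resolve_left hp
    refine ⟨Or.inr ?_, safe_of_mem_Xrec hu hrec⟩
    by_cases hR : πR (fH p (πH p)) = uR0
    · rw [hR]
      exact step_mem_Xrec hu hrec
    · exact hshield _ hR
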